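/- Let H be a complex separable Hilbert space, φ, ψ ∈ H, and A a contraction on H (‖A‖ ≤ 1). Let h(w) = 1 + w⟨(I - wA)^{-1}φ, ψ⟩ for w ∈ 𝔻. Then for any finite set of zeros z₁, ..., z_N of h in 𝔻 (each repeated at most according to its order): ∑_{n=1}^N (|z_n|^{-1} - 1) ≤ ‖φ‖·‖ψ‖. -/

import Mathlib

open Metric

/-- If `L` acts triangularly on linearly independent vectors, with diagonal `μ`, then some
orthonormal family exhibits `μ` as its diagonal matrix coefficients. -/
theorem exists_orthonormal_inner_eq_of_triangular
    {H : Type*} [NormedAddCommGroup H] [InnerProductSpace ℂ H] {N : ℕ}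
    (L : H →L[ℂ] H) (f : Fin N → H) (μ : Fin N → ℂ) (hf : LinearIndependent ℂ f)
    (hL : ∀ k, L (f k) - μ k • f k ∈ Submodule.span ℂ (f '' Set.Iio k)) :
    ∃ e : Fin N → H, Orthonormal ℂ e ∧ ∀ k, inner ℂ (e k) (L (e k)) = μ k := by
  set e := InnerProductSpace.gramSchmidtNormed ℂ f with he
  have ho : Orthonormal ℂ e := InnerProductSpace.gramSchmidtNormed_orthonormal hf
  refine ⟨e, ho, fun k => ?_⟩
  have hmem : e k ∈ Submodule.span ℂ (f '' Set.Iic k) := by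
    rw [← InnerProductSpace.span_gramSchmidt_Iic, ← InnerProductSpace.span_gramSchmidtNormed]
    exact Submodule.subset_span ⟨k, Set.self_mem_Iic, rfl⟩
  have hlow : ∀ v ∈ Submodule.span ℂ (f '' Set.Iic k),
      L v - μ k • v ∈ Submodule.span ℂ (f '' Set.Iio k) := by
    intro v hv
    induction hv using Submodule.span_induction with
    | mem x hx =>
      obtain ⟨j, hj, rfl⟩ := hx
      rcases (Set.mem_Iic.1 hj).eq_or_lt with rfl | hjk
      · exact hL j
      · have h1 : f j ∈ Submodule.span ℂ (f '' Set.Iio k) :=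
          Submodule.subset_span ⟨j, hjk, rfl⟩
        have h2 := Submodule.span_mono (Set.image_mono (Set.Iio_subset_Iio hjk.le)) (hL j)
        have h3 := Submodule.add_mem _ h2 (Submodule.smul_mem _ (μ j - μ k) h1)
        convert h3 using 1
        module
    | zero => simp
    | add x y _ _ hx hy =>
      convert Submodule.add_mem _ hx hy using 1
      rw [map_add]
      module
    | smul c x _ hx =>
      convert Submodule.smul_mem _ c hx using 1
      rw [map_smul]
      module
  have horth : ∀ v ∈ Submodule.span ℂ (f '' Set.Iio k), inner ℂ (e k) v = 0 := by
    intro v hv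
    rw [← InnerProductSpace.span_gramSchmidt_Iio, ← InnerProductSpace.span_gramSchmidtNormed] at hv
    induction hv using Submodule.span_induction with
    | mem x hx =>
      obtain ⟨j, hj, rfl⟩ := hx
      exact ho.2 (ne_of_gt hj)
    | zero => simp
    | add x y _ _ hx hy => rw [inner_add_right, hx, hy, add_zero]
    | smul c x _ hx => rw [inner_smul_right, hx, mul_zero]
  have h0 := horth _ (hlow _ hmem)
  rw [inner_sub_right, inner_smul_right, inner_self_eq_norm_sq_to_K, ho.1 k] at h0
  simpa [sub_eq_zero] using h0

/-- The sum of the absolute matrix coefficients of a rank-one operator along an orthonormal family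
is at most its trace norm. -/
theorem Orthonormal.sum_norm_inner_mul_norm_inner_le
    {H : Type*} [NormedAddCommGroup H] [InnerProductSpace ℂ H] {ι : Type*} [Fintype ι]
    {e : ι → H} (he : Orthonormal ℂ e) (x y : H) :
    ∑ k, ‖inner ℂ (e k) x‖ * ‖inner ℂ (e k) y‖ ≤ ‖x‖ * ‖y‖ := by
  refine (Real.sum_mul_le_sqrt_mul_sqrt _ _ _).trans ?_
  gcongr
  · exact Real.sqrt_le_left (norm_nonneg x) |>.2 (he.sum_inner_products_le x)
  · exact Real.sqrt_le_left (norm_nonneg y) |>.2 (he.sum_inner_products_le y)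

theorem sum_norm_sub_one_le_of_triangular
    {H : Type*} [NormedAddCommGroup H] [InnerProductSpace ℂ H] {N : ℕ}
    (φ ψ : H) (A : H →L[ℂ] H) (hA : ‖A‖ ≤ 1) (f : Fin N → H) (μ : Fin N → ℂ)
    (hf : LinearIndependent ℂ f)
    (hL : ∀ k, A (f k) - inner ℂ ψ (f k) • φ - μ k • f k ∈ Submodule.span ℂ (f '' Set.Iio k)) :
    ∑ k, (‖μ k‖ - 1) ≤ ‖φ‖ * ‖ψ‖ := by
  obtain ⟨e, he, hμ⟩ := exists_orthonormal_inner_eq_of_triangular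
    (A - (innerSL ℂ ψ).smulRight φ) f μ hf (by simpa using hL)
  refine (Finset.sum_le_sum fun k _ => ?_).trans (he.sum_norm_inner_mul_norm_inner_le φ ψ)
  have h1 : ‖inner ℂ (e k) (A (e k))‖ ≤ 1 := by
    refine (norm_inner_le_norm _ _).trans ?_
    rw [he.1 k, one_mul]
    simpa [he.1 k] using (A.le_of_opNorm_le hA (e k))
  have h2 : μ k = inner ℂ (e k) (A (e k)) - inner ℂ ψ (e k) * inner ℂ (e k) φ := by
    rw [← hμ k]
    simp
  have h3 := norm_sub_le (inner ℂ (e k) (A (e k))) (inner ℂ ψ (e k) * inner ℂ (e k) φ)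
  rw [← h2, norm_mul, norm_inner_symm ψ, mul_comm ‖inner ℂ (e k) ψ‖] at h3
  linarith

open Polynomial in
theorem Polynomial.eq_zero_of_sum_smul_prod_X_sub_C_eq_zero (z a : ℕ → ℂ) (N : ℕ)
    (h : ∑ k ∈ Finset.range N, C (a k) * ∏ j ∈ Finset.Ico (k + 1) N, (X - C (z j)) = 0) :
    ∀ k < N, a k = 0 := by
  induction N with
  | zero => simp
  | succ N ih =>
    have hstep : ∑ k ∈ Finset.range N, C (a k) * ∏ j ∈ Finset.Ico (k + 1) (N + 1), (X - C (z j))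
        = (∑ k ∈ Finset.range N, C (a k) * ∏ j ∈ Finset.Ico (k + 1) N, (X - C (z j)))
          * (X - C (z N)) := by
      rw [Finset.sum_mul]
      refine Finset.sum_congr rfl fun k hk => ?_
      rw [Finset.prod_Ico_succ_top (Finset.mem_range.1 hk), mul_assoc]
    rw [Finset.sum_range_succ, hstep, Finset.Ico_self, Finset.prod_empty, mul_one] at h
    have haN : a N = 0 := by simpa using congrArg (eval (z N)) h
    rw [haN, C_0, add_zero] at h
    have h' := (mul_eq_zero.1 h).resolve_right (X_sub_C_ne_zero _)
    intro k hk
    rcases (Nat.lt_succ_iff.1 hk).eq_or_lt with rfl | hk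
    · exact haN
    · exact ih h' k hk

section Resolvent

variable {H : Type*} [NormedAddCommGroup H] [InnerProductSpace ℂ H] [CompleteSpace H]
  {A : H →L[ℂ] H} {w z : ℂ}

theorem isUnit_one_sub_smul_of_mem_ball (hA : ‖A‖ ≤ 1) (hw : w ∈ ball (0 : ℂ) 1) :
    IsUnit (1 - w • A) := by
  refine isUnit_one_sub_of_norm_lt_one ?_
  rw [norm_smul]
  have hw' : ‖w‖ < 1 := by simpa using hw
  nlinarith [norm_nonneg w, norm_nonneg A]

theorem inverse_one_sub_smul_apply (hA : ‖A‖ ≤ 1) (hw : w ∈ ball (0 : ℂ) 1) (x : H) :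
    Ring.inverse (1 - w • A) x = x + w • A (Ring.inverse (1 - w • A) x) := by
  have h := Ring.mul_inverse_cancel _ (isUnit_one_sub_smul_of_mem_ball hA hw)
  have h' := congrArg (fun T : H →L[ℂ] H => T x) h
  simp only [mul_apply_eq_comp, sub_apply,
    one_apply_eq_self, smul_apply] at h'
  exact sub_eq_iff_eq_add.1 h'

theorem inverse_one_sub_smul_apply' (hA : ‖A‖ ≤ 1) (hw : w ∈ ball (0 : ℂ) 1) (x : H) :
    Ring.inverse (1 - w • A) x = x + w • Ring.inverse (1 - w • A) (A x) := by
  have h := Ring.inverse_mul_cancel _ (isUnit_one_sub_smul_of_mem_ball hA hw)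
  have h' := congrArg (fun T : H →L[ℂ] H => T x) h
  simp only [mul_apply_eq_comp, sub_apply,
    one_apply_eq_self, smul_apply, map_sub, map_smul] at h'
  exact sub_eq_iff_eq_add.1 h'

theorem smul_inverse_one_sub_smul_sub (hA : ‖A‖ ≤ 1) (hw : w ∈ ball (0 : ℂ) 1)
    (hz : z ∈ ball (0 : ℂ) 1) (x : H) :
    w • Ring.inverse (1 - w • A) x - z • Ring.inverse (1 - z • A) x
      = (w - z) • Ring.inverse (1 - w • A) (Ring.inverse (1 - z • A) x) := by
  set y := Ring.inverse (1 - z • A) x with hy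
  have hx : x = y - z • A y := by
    rw [eq_sub_iff_add_eq]
    exact (inverse_one_sub_smul_apply hA hz x).symm
  have h := inverse_one_sub_smul_apply' hA hw y
  rw [hx, map_sub, map_smul, smul_sub, sub_smul]
  have h' : z • Ring.inverse (1 - w • A) y = z • y + z • w • Ring.inverse (1 - w • A) (A y) := by
    rw [← smul_add, ← h]
  rw [h', smul_comm z w]
  abel

theorem continuousOn_inner_inverse_one_sub_smul (hA : ‖A‖ ≤ 1) (x y : H) :
    ContinuousOn (fun w : ℂ => inner ℂ y (Ring.inverse (1 - w • A) x)) (ball 0 1) := by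
  intro w hw
  obtain ⟨u, hu⟩ := isUnit_one_sub_smul_of_mem_ball hA hw
  have h1 : ContinuousAt (fun w : ℂ => Ring.inverse (1 - w • A)) w := by
    refine ContinuousAt.comp (g := Ring.inverse) (f := fun w : ℂ => 1 - w • A) ?_ (by fun_prop)
    rw [← hu]
    exact NormedRing.inverse_continuousAt u
  exact (ContinuousAt.inner (𝕜 := ℂ) continuousAt_const (h1.clm_apply continuousAt_const)).continuousWithinAt

/-- Dividing `w ↦ c + w ⟨(1 - wA)⁻¹ x, ψ⟩` by `w - z` at a zero `z`. -/
theorem inner_inverse_eq_of_eq_sub_mul (hA : ‖A‖ ≤ 1) (hz : z ∈ ball (0 : ℂ) 1) {ψ x : H} {c : ℂ}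
    {G : ℂ → ℂ} (hG : ContinuousOn G (ball 0 1))
    (h : ∀ w ∈ ball (0 : ℂ) 1,
      c + w * inner ℂ ψ (Ring.inverse (1 - w • A) x) = (w - z) * G w) :
    ∀ w ∈ ball (0 : ℂ) 1,
      inner ℂ ψ (Ring.inverse (1 - w • A) (Ring.inverse (1 - z • A) x)) = G w := by
  have hne : ∀ w ∈ ball (0 : ℂ) 1, w ≠ z →
      inner ℂ ψ (Ring.inverse (1 - w • A) (Ring.inverse (1 - z • A) x)) = G w := by
    intro w hw hwz
    refine mul_left_cancel₀ (sub_ne_zero.2 hwz) ?_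
    rw [← h w hw, ← inner_smul_right, ← smul_inverse_one_sub_smul_sub hA hw hz, inner_sub_right,
      inner_smul_right, inner_smul_right]
    have := h z hz
    rw [sub_self, zero_mul] at this
    linear_combination -this
  intro w hw
  by_cases hwz : w = z
  · subst hwz
    have hb : ball (0 : ℂ) 1 ∈ nhds w := isOpen_ball.mem_nhds hw
    have h1 := ((continuousOn_inner_inverse_one_sub_smul hA
      (Ring.inverse (1 - w • A) x) ψ).continuousAt hb).tendsto.mono_left
      (nhdsWithin_le_nhds (s := {w}ᶜ))
    have h2 := (hG.continuousAt hb).tendsto.mono_left (nhdsWithin_le_nhds (s := {w}ᶜ))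
    refine tendsto_nhds_unique_of_eventuallyEq h1 h2 ?_
    filter_upwards [self_mem_nhdsWithin, nhdsWithin_le_nhds hb] with v hv hvb
    exact hne v hvb hv
  · exact hne w hw hwz

/-- The candidate Jordan chain vectors: `A ^ k` applied to the product of the resolvents at
`z 0, …, z k`, applied to `φ`. -/
noncomputable def resolventChain (A : H →L[ℂ] H) (φ : H) (z : ℕ → ℂ) : ℕ → H
  | 0 => Ring.inverse (1 - z 0 • A) φ
  | k + 1 => Ring.inverse (1 - z (k + 1) • A) (A (resolventChain A φ z k))

theorem inner_inverse_resolventChain (hA : ‖A‖ ≤ 1) (φ ψ : H) (z : ℕ → ℂ) (N : ℕ)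
    (hz : ∀ n < N, z n ∈ ball (0 : ℂ) 1) {g : ℂ → ℂ} (hg : ContinuousOn g (ball 0 1))
    (h : ∀ w ∈ ball (0 : ℂ) 1, 1 + w * inner ℂ ψ (Ring.inverse (1 - w • A) φ)
      = (∏ n ∈ Finset.range N, (w - z n)) * g w) (k : ℕ) (hk : k < N) :
    ∀ w ∈ ball (0 : ℂ) 1, inner ℂ ψ (Ring.inverse (1 - w • A) (resolventChain A φ z k))
      = (∏ n ∈ Finset.Ico (k + 1) N, (w - z n)) * g w := by
  have hcont (k : ℕ) :
      ContinuousOn (fun w => (∏ n ∈ Finset.Ico (k + 1) N, (w - z n)) * g w) (ball 0 1) :=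
    ContinuousOn.mul (by fun_prop) hg
  induction k with
  | zero =>
    refine inner_inverse_eq_of_eq_sub_mul hA (hz 0 hk) (hcont 0) (c := 1) fun w hw => ?_
    rw [h w hw, Finset.range_eq_Ico, Finset.prod_eq_prod_Ico_succ_bot hk, mul_assoc]
  | succ k ih =>
    refine inner_inverse_eq_of_eq_sub_mul hA (hz _ hk) (hcont _)
      (c := inner ℂ ψ (resolventChain A φ z k)) fun w hw => ?_
    rw [← mul_assoc, ← Finset.prod_eq_prod_Ico_succ_bot hk (fun n => w - z n), ← ih (by omega) w hw,
      inverse_one_sub_smul_apply' hA hw (resolventChain A φ z k), inner_add_right,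
      inner_smul_right]

theorem linearIndependent_resolventChain (hA : ‖A‖ ≤ 1) (φ ψ : H) (z : ℕ → ℂ) (N : ℕ)
    (hz : ∀ n < N, z n ∈ ball (0 : ℂ) 1) {g : ℂ → ℂ} (hg : ContinuousOn g (ball 0 1))
    (h : ∀ w ∈ ball (0 : ℂ) 1, 1 + w * inner ℂ ψ (Ring.inverse (1 - w • A) φ)
      = (∏ n ∈ Finset.range N, (w - z n)) * g w) :
    LinearIndependent ℂ (fun k : Fin N => resolventChain A φ z k) := by
  rw [Fintype.linearIndependent_iff]
  intro b hb
  let a : ℕ → ℂ := fun k => if hk : k < N then b ⟨k, hk⟩ else 0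
  have hab (k : Fin N) : a k = b k := by simp [a]
  have hsum : ∑ k ∈ Finset.range N, a k • resolventChain A φ z k = 0 := by
    rw [Finset.sum_range, ← hb]
    exact Finset.sum_congr rfl fun k _ => by rw [hab]
  have h0 : (0 : ℂ) ∈ ball (0 : ℂ) 1 := by simp
  have hg0 : g 0 ≠ 0 := by
    intro hg0
    simpa [hg0] using h 0 h0
  have hb0 : ball (0 : ℂ) 1 ∈ nhds 0 := isOpen_ball.mem_nhds h0
  have hinf : {w | w ∈ ball (0 : ℂ) 1 ∧ g w ≠ 0}.Infinite :=
    infinite_of_mem_nhds 0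
      (Filter.inter_mem hb0 ((hg.continuousAt hb0).eventually_ne hg0))
  have hpoly := Polynomial.eq_zero_of_infinite_isRoot
    (∑ k ∈ Finset.range N, Polynomial.C (a k) *
      ∏ j ∈ Finset.Ico (k + 1) N, (Polynomial.X - Polynomial.C (z j)))
    (hinf.mono fun w hw => by
      have hη := congrArg (fun v => inner ℂ ψ (Ring.inverse (1 - w • A) v)) hsum
      simp only [map_sum, map_smul, inner_sum, inner_smul_right, map_zero, inner_zero_right] at hη
      have hη' : (∑ k ∈ Finset.range N, a k * ∏ n ∈ Finset.Ico (k + 1) N, (w - z n)) * g w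
          = 0 := by
        rw [← hη, Finset.sum_mul]
        refine Finset.sum_congr rfl fun k hk => ?_
        rw [inner_inverse_resolventChain hA φ ψ z N hz hg h k (Finset.mem_range.1 hk) w hw.1,
          mul_assoc]
      simpa [Polynomial.IsRoot, Polynomial.eval_finsetSum, Polynomial.eval_prod] using
        (mul_eq_zero.1 hη').resolve_right hw.2)
  intro k
  rw [← hab]
  exact Polynomial.eq_zero_of_sum_smul_prod_X_sub_C_eq_zero z a N hpoly k k.2

theorem resolventChain_triangular (hA : ‖A‖ ≤ 1) (φ ψ : H) (z : ℕ → ℂ) (N : ℕ)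
    (hz : ∀ n < N, z n ∈ ball (0 : ℂ) 1) {g : ℂ → ℂ} (hg : ContinuousOn g (ball 0 1))
    (h : ∀ w ∈ ball (0 : ℂ) 1, 1 + w * inner ℂ ψ (Ring.inverse (1 - w • A) φ)
      = (∏ n ∈ Finset.range N, (w - z n)) * g w) (k : ℕ) (hk : k < N) :
    A (resolventChain A φ z k) - inner ℂ ψ (resolventChain A φ z k) • φ
        - (z k)⁻¹ • resolventChain A φ z k
      ∈ Submodule.span ℂ (resolventChain A φ z '' Set.Iio k) := by
  set f := resolventChain A φ z with hf
  have hz0 (n : ℕ) (hn : n < N) : z n ≠ 0 := by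
    intro h0
    have := h 0 (by simp)
    rw [Finset.prod_eq_zero (Finset.mem_range.2 hn) (by simp [h0])] at this
    simp at this
  induction k with
  | zero =>
    have h1 : f 0 = φ + z 0 • A (f 0) := inverse_one_sub_smul_apply hA (hz 0 hk) φ
    have h2 : 1 + z 0 * inner ℂ ψ (f 0) = 0 := by
      have := h (z 0) (hz 0 hk)
      rwa [Finset.prod_eq_zero (Finset.mem_range.2 hk) (sub_self _), zero_mul] at this
    convert Submodule.zero_mem _ using 1
    refine smul_right_injective H (hz0 0 hk) ?_
    have h3 : z 0 • inner ℂ ψ (f 0) • φ = -φ := by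
      rw [smul_smul, show z 0 * inner ℂ ψ (f 0) = -1 by linear_combination h2, neg_one_smul]
    simp only [smul_sub, smul_zero, smul_inv_smul₀ (hz0 0 hk), h3]
    nth_rw 2 [h1]
    abel
  | succ k ih =>
    have h1 : f (k + 1) = A (f k) + z (k + 1) • A (f (k + 1)) :=
      inverse_one_sub_smul_apply hA (hz _ hk) (A (f k))
    have h2 : inner ℂ ψ (f k) + z (k + 1) * inner ℂ ψ (f (k + 1)) = 0 := by
      have h3 := inner_inverse_resolventChain hA φ ψ z N hz hg h k (by omega) (z (k + 1)) (hz _ hk)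
      rw [Finset.prod_eq_zero (Finset.mem_Ico.2 ⟨le_rfl, hk⟩) (sub_self _), zero_mul,
        inverse_one_sub_smul_apply' hA (hz _ hk), inner_add_right, inner_smul_right] at h3
      exact h3
    have h3 : A (f k) - inner ℂ ψ (f k) • φ ∈ Submodule.span ℂ (f '' Set.Iio (k + 1)) := by
      have h4 := Submodule.span_mono (Set.image_mono (Set.Iio_subset_Iio k.le_succ))
        (ih (by omega))
      have h5 : f k ∈ Submodule.span ℂ (f '' Set.Iio (k + 1)) :=
        Submodule.subset_span ⟨k, Set.mem_Iio.2 k.lt_succ_self, rfl⟩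
      simpa using Submodule.add_mem _ h4 (Submodule.smul_mem _ (z k)⁻¹ h5)
    convert Submodule.smul_mem _ (-(z (k + 1))⁻¹) h3 using 1
    refine smul_right_injective H (hz0 _ hk) ?_
    have h4 : z (k + 1) • inner ℂ ψ (f (k + 1)) • φ = -(inner ℂ ψ (f k) • φ) := by
      rw [smul_smul, ← neg_smul]
      congr 1
      linear_combination h2
    simp only [smul_sub, neg_smul, smul_neg, smul_inv_smul₀ (hz0 _ hk), h4]
    nth_rw 2 [h1]
    abel

end Resolvent

/-- Theorem 1.1 of the paper. Let `H` be a complex separable Hilbert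
space, `φ, ψ ∈ H`, `A` a contraction on `H`, and
`h(w) = 1 + w ⟨(I - wA)⁻¹ φ, ψ⟩` on the unit disk (inner product linear in the first
slot: `⟨u, ψ⟩ = inner ψ u` in Mathlib's convention). Then any finite list of zeros of
`h` in `𝔻`, each repeated at most according to its order (encoded via a holomorphic
factorization), satisfies `∑ₙ (|zₙ|⁻¹ - 1) ≤ ‖φ‖·‖ψ‖`. -/
theorem sum_zeros_le_norm_mul_norm
    {H : Type*} [NormedAddCommGroup H] [InnerProductSpace ℂ H] [CompleteSpace H]
    [TopologicalSpace.SeparableSpace H]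
    (φ ψ : H) (A : H →L[ℂ] H) (hA : ‖A‖ ≤ 1)
    (h : ℂ → ℂ)
    (hdef : ∀ w ∈ ball (0:ℂ) 1,
      h w = 1 + w * @inner ℂ _ _ ψ ((Ring.inverse (1 - w • A)) φ))
    (N : ℕ) (z : Fin N → ℂ) (hz : ∀ n, z n ∈ ball (0:ℂ) 1)
    (hfac : ∃ g : ℂ → ℂ, DifferentiableOn ℂ g (ball (0:ℂ) 1) ∧
      ∀ w ∈ ball (0:ℂ) 1, h w = (∏ n, (w - z n)) * g w) :
    ∑ n, (‖z n‖⁻¹ - 1) ≤ ‖φ‖ * ‖ψ‖ := by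
  obtain ⟨g, hg, hfac⟩ := hfac
  let y : ℕ → ℂ := fun n => if hn : n < N then z ⟨n, hn⟩ else 0
  have hyz (k : Fin N) : y k = z k := by simp [y]
  have hy : ∀ n < N, y n ∈ ball (0 : ℂ) 1 := fun n hn => by simpa [y, hn] using hz ⟨n, hn⟩
  have hh : ∀ w ∈ ball (0 : ℂ) 1, 1 + w * inner ℂ ψ (Ring.inverse (1 - w • A) φ)
      = (∏ n ∈ Finset.range N, (w - y n)) * g w := by
    intro w hw
    simp_rw [← hdef w hw, hfac w hw, Finset.prod_range, hyz]
  have key := sum_norm_sub_one_le_of_triangular φ ψ A hA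
    (fun k : Fin N => resolventChain A φ y k) (fun k => (z k)⁻¹)
    (linearIndependent_resolventChain hA φ ψ y N hy hg.continuousOn hh) fun k => by
      have h1 := resolventChain_triangular hA φ ψ y N hy hg.continuousOn hh k k.2
      rw [hyz] at h1
      refine Submodule.span_mono ?_ h1
      rintro _ ⟨j, hj, rfl⟩
      exact ⟨⟨j, hj.trans k.2⟩, hj, rfl⟩
  simpa only [norm_inv] using key
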